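/- arXiv:1209.3941 — 2 statements merged into one kernel-verified Lean document; each statement's English description precedes it below -/
import Mathlib

section
/- Suppose the columns a_1,…,a_n of A generate ℤ^d as a ℤ-module, A is homogeneous, and ℕA is saturated. Then ℤ^d \ sRes(A) = ℕA; that is, an integer vector β ∈ ℤ^d lies outside sRes(A) if and only if β ∈ ℕA. -/
noncomputable section

open scoped BigOperators

variable {d n : ℕ}

/-- The `i`-th column of the integer matrix `A`, as a vector in `ℤ^d`. -/
def colZ (A : Matrix (Fin d) (Fin n) ℤ) (i : Fin n) : Fin d → ℤ := fun k => A k i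

/-- The `i`-th column of `A`, viewed in `ℝ^d`. -/
def colR (A : Matrix (Fin d) (Fin n) ℤ) (i : Fin n) : Fin d → ℝ := fun k => (A k i : ℝ)

/-- The `i`-th column of `A`, viewed in `ℂ^d`. -/
def colC (A : Matrix (Fin d) (Fin n) ℤ) (i : Fin n) : Fin d → ℂ := fun k => (A k i : ℂ)

/-- The canonical embedding `ℤ^d → ℂ^d`. -/
def zToC (m : Fin d → ℤ) : Fin d → ℂ := fun k => (m k : ℂ)

/-- The canonical embedding `ℝ^d → ℂ^d`. -/
def rToC (x : Fin d → ℝ) : Fin d → ℂ := fun k => (x k : ℂ)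

/-- The canonical embedding `ℚ^d → ℂ^d`. -/
def qToC (x : Fin d → ℚ) : Fin d → ℂ := fun k => (x k : ℂ)

/-- `ℕA`, the semigroup generated by the columns of `A` in `ℤ^d`. -/
def NA (A : Matrix (Fin d) (Fin n) ℤ) : Set (Fin d → ℤ) :=
  {m | ∃ γ : Fin n → ℕ, m = ∑ i, (γ i : ℤ) • colZ A i}

/-- `ℝ₊A`, the cone of nonnegative real combinations of the columns of `A` in `ℝ^d`. -/
def RplusA (A : Matrix (Fin d) (Fin n) ℤ) : Set (Fin d → ℝ) :=
  {x | ∃ c : Fin n → ℝ, (∀ i, 0 ≤ c i) ∧ x = ∑ i, c i • colR A i}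

/-- `ℚ₊A`, the nonnegative rational combinations of the columns of `A` in `ℚ^d`. -/
def QplusA (A : Matrix (Fin d) (Fin n) ℤ) : Set (Fin d → ℚ) :=
  {x | ∃ c : Fin n → ℚ, (∀ i, 0 ≤ c i) ∧ x = ∑ i, c i • (fun k => (A k i : ℚ))}

/-- The Zariski closure of a subset of `ℂ^d`: the common zeros of all polynomials
vanishing on it. -/
def zclosure (S : Set (Fin d → ℂ)) : Set (Fin d → ℂ) :=
  {x | ∀ p : MvPolynomial (Fin d) ℂ,
    (∀ s ∈ S, MvPolynomial.eval s p = 0) → MvPolynomial.eval x p = 0}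

/-- `qdeg_j(A)`: the Zariski closure in `ℂ^d` of `ℕA \ (a_j + ℕA)`. -/
def qdeg (A : Matrix (Fin d) (Fin n) ℤ) (j : Fin n) : Set (Fin d → ℂ) :=
  zclosure (zToC '' (NA A \ {m | ∃ m' ∈ NA A, m = colZ A j + m'}))

/-- `sRes(A) = ⋃_j ⋃_{l ∈ ℕ} ( -(l+1)·a_j + qdeg_j(A) )`, the set of strongly
resonant parameters of `A`. -/
def sRes (A : Matrix (Fin d) (Fin n) ℤ) : Set (Fin d → ℂ) :=
  ⋃ j : Fin n, ⋃ l : ℕ, (fun q => q - ((l : ℂ) + 1) • colC A j) '' qdeg A j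

/-- A finitely generated cone over an ordered field is a finite intersection of half-spaces
(Minkowski–Weyl), by Fourier–Motzkin elimination of the coefficients. -/
theorem exists_finset_dual_eq_cone {K : Type*} [Field K] [LinearOrder K] [IsStrictOrderedRing K]
    {m n : ℕ} (a : Fin n → Fin m → K) :
    ∃ Φ : Finset ((Fin m → K) →ₗ[K] K), ∀ x : Fin m → K,
      (∃ c : Fin n → K, (∀ i, 0 ≤ c i) ∧ x = ∑ i, c i • a i) ↔ ∀ φ ∈ Φ, 0 ≤ φ x := by
  classical
  induction n with
  | zero =>
    refine ⟨Finset.univ.image (fun k => LinearMap.proj k) ∪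
      Finset.univ.image (fun k => -LinearMap.proj k), fun x => ?_⟩
    constructor
    · rintro ⟨c, -, rfl⟩ φ -
      simp
    · intro h
      refine ⟨fun _ => 0, fun _ => le_rfl, ?_⟩
      ext k
      have h1 := h (LinearMap.proj k) (by simp)
      have h2 := h (-LinearMap.proj k) (by simp)
      simp only [LinearMap.neg_apply, LinearMap.proj_apply] at h1 h2
      simp only [Finset.univ_eq_empty, Finset.sum_empty, Pi.zero_apply]
      linarith
  | succ n ih =>
    obtain ⟨Φ, hΦ⟩ := ih (fun i => a i.succ)
    have key : ∀ x : Fin m → K,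
        (∃ c : Fin (n + 1) → K, (∀ i, 0 ≤ c i) ∧ x = ∑ i, c i • a i) ↔
          ∃ t : K, 0 ≤ t ∧ ∀ φ ∈ Φ, t * φ (a 0) ≤ φ x := by
      intro x
      constructor
      · rintro ⟨c, hc, rfl⟩
        refine ⟨c 0, hc 0, fun φ hφ => ?_⟩
        have := (hΦ (∑ i : Fin n, c i.succ • a i.succ)).1
          ⟨fun i => c i.succ, fun i => hc _, rfl⟩ φ hφ
        rw [Fin.sum_univ_succ, map_add, map_smul, smul_eq_mul]
        linarith
      · rintro ⟨t, ht, h⟩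
        obtain ⟨c, hc, hx⟩ := (hΦ (x - t • a 0)).2 (fun φ hφ => by
          have := h φ hφ
          rw [map_sub, map_smul, smul_eq_mul]
          linarith)
        refine ⟨Fin.cons t c, fun i => ?_, ?_⟩
        · cases i using Fin.cases with
          | zero => simpa using ht
          | succ i => simpa using hc i
        · rw [Fin.sum_univ_succ]
          simp only [Fin.cons_zero, Fin.cons_succ]
          rw [← hx]
          abel
    refine ⟨Φ.filter (fun φ => 0 ≤ φ (a 0)) ∪
      ((Φ.filter (fun φ => 0 < φ (a 0))) ×ˢ (Φ.filter (fun φ => φ (a 0) < 0))).image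
        (fun q => q.1 (a 0) • q.2 - q.2 (a 0) • q.1), fun x => ?_⟩
    rw [key]
    constructor
    · rintro ⟨t, ht, h⟩ φ hφ
      rcases Finset.mem_union.1 hφ with hφ | hφ
      · rw [Finset.mem_filter] at hφ
        exact (mul_nonneg ht hφ.2).trans (h φ hφ.1)
      · obtain ⟨⟨p, q⟩, hpq, rfl⟩ := Finset.mem_image.1 hφ
        simp only [Finset.mem_product, Finset.mem_filter] at hpq
        obtain ⟨⟨hp, hp0⟩, hq, hq0⟩ := hpq
        simp only [LinearMap.sub_apply, LinearMap.smul_apply, smul_eq_mul]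
        nlinarith [mul_le_mul_of_nonneg_left (h q hq) hp0.le,
          mul_le_mul_of_nonpos_left (h p hp) hq0.le]
    · intro h
      have hne : (insert 0 ((Φ.filter (fun φ => φ (a 0) < 0)).image
        (fun q => q x / q (a 0)))).Nonempty := Finset.insert_nonempty _ _
      set L := insert 0 ((Φ.filter (fun φ => φ (a 0) < 0)).image (fun q => q x / q (a 0)))
        with hL
      refine ⟨L.max' hne, L.le_max' _ (Finset.mem_insert_self _ _), fun φ hφ => ?_⟩
      rcases lt_or_ge (φ (a 0)) 0 with hneg | hnonneg
      · have : φ x / φ (a 0) ≤ L.max' hne := L.le_max' _ (Finset.mem_insert_of_mem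
          (Finset.mem_image.2 ⟨φ, Finset.mem_filter.2 ⟨hφ, hneg⟩, rfl⟩))
        exact (div_le_iff_of_neg hneg).1 this
      · have hφx : 0 ≤ φ x :=
          h φ (Finset.mem_union_left _ (Finset.mem_filter.2 ⟨hφ, hnonneg⟩))
        rcases Finset.mem_insert.1 (L.max'_mem hne) with hmax | hmax
        · simpa [hmax] using hφx
        · obtain ⟨q, hq, hmax⟩ := Finset.mem_image.1 hmax
          rw [← hmax]
          rcases hnonneg.eq_or_lt with h0 | hpos
          · simpa [← h0] using hφx
          · have hq0 := (Finset.mem_filter.1 hq).2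
            have hpq := h (φ (a 0) • q - q (a 0) • φ) (Finset.mem_union_right _
              (Finset.mem_image.2 ⟨(φ, q), Finset.mem_product.2
                ⟨Finset.mem_filter.2 ⟨hφ, hpos⟩, hq⟩, rfl⟩))
            simp only [LinearMap.sub_apply, LinearMap.smul_apply, smul_eq_mul] at hpq
            rw [div_mul_eq_mul_div, div_le_iff_of_neg hq0]
            linarith

/-- A rational linear functional has the same sign on integer vectors as an integral one. -/
theorem exists_int_dotProduct_nonneg_iff (φ : (Fin d → ℚ) →ₗ[ℚ] ℚ) :
    ∃ ψ : Fin d → ℤ, ∀ m : Fin d → ℤ, 0 ≤ φ (fun k => (m k : ℚ)) ↔ 0 ≤ ψ ⬝ᵥ m := by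
  obtain ⟨b, hb⟩ := IsLocalization.exist_integer_multiples_of_finite (nonZeroDivisors ℤ)
    (fun k : Fin d => φ (Pi.single k 1))
  choose c hc using hb
  have hb0 : (0 : ℚ) < (b : ℤ) * (b : ℤ) := by
    have : ((b : ℤ) : ℚ) ≠ 0 := Int.cast_ne_zero.2 (nonZeroDivisors.coe_ne_zero b)
    exact mul_self_pos.2 this
  refine ⟨fun k => b * c k, fun m => ?_⟩
  have hm : (((fun k => b * c k) ⬝ᵥ m : ℤ) : ℚ) =
      ((b : ℤ) * (b : ℤ) : ℚ) * φ (fun k => (m k : ℚ)) := by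
    rw [LinearMap.pi_apply_eq_sum_univ φ, dotProduct, Finset.mul_sum]
    push_cast
    refine Finset.sum_congr rfl fun k _ => ?_
    have hk : (c k : ℚ) = (b : ℤ) * φ (Pi.single k 1) := by
      have := hc k
      rwa [eq_intCast, zsmul_eq_mul] at this
    have hs : (fun j => if k = j then (1 : ℚ) else 0) = Pi.single k 1 := by
      ext j
      simp [Pi.single_apply, eq_comm]
    rw [hk, hs, smul_eq_mul]
    ring
  rw [← @Int.cast_nonneg_iff ℚ, hm, mul_nonneg_iff_of_pos_left hb0]

/-- A saturated affine semigroup is the set of integer points of a rational polyhedral cone. -/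
theorem exists_finset_mem_NA_iff (A : Matrix (Fin d) (Fin n) ℤ)
    (hsat : NA A = {m : Fin d → ℤ | (fun k => (m k : ℚ)) ∈ QplusA A}) :
    ∃ Ψ : Finset (Fin d → ℤ), ∀ m, m ∈ NA A ↔ ∀ ψ ∈ Ψ, 0 ≤ ψ ⬝ᵥ m := by
  classical
  obtain ⟨Φ, hΦ⟩ := exists_finset_dual_eq_cone (fun (i : Fin n) (k : Fin d) => (A k i : ℚ))
  choose ψ hψ using exists_int_dotProduct_nonneg_iff (d := d)
  refine ⟨Φ.image ψ, fun m => ?_⟩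
  rw [hsat, Finset.forall_mem_image]
  exact (hΦ _).trans (forall₂_congr fun φ _ => hψ φ m)

theorem zero_mem_NA (A : Matrix (Fin d) (Fin n) ℤ) : (0 : Fin d → ℤ) ∈ NA A :=
  ⟨0, by simp⟩

theorem add_mem_NA {A : Matrix (Fin d) (Fin n) ℤ} {x y : Fin d → ℤ} (hx : x ∈ NA A)
    (hy : y ∈ NA A) : x + y ∈ NA A := by
  obtain ⟨γ, rfl⟩ := hx
  obtain ⟨δ, rfl⟩ := hy
  exact ⟨γ + δ, by simp [add_smul, Finset.sum_add_distrib]⟩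

theorem nsmul_mem_NA {A : Matrix (Fin d) (Fin n) ℤ} {x : Fin d → ℤ} (hx : x ∈ NA A) (N : ℕ) :
    N • x ∈ NA A := by
  obtain ⟨γ, rfl⟩ := hx
  exact ⟨N • γ, by simp [Finset.smul_sum, mul_smul]⟩

theorem colZ_mem_NA (A : Matrix (Fin d) (Fin n) ℤ) (i : Fin n) : colZ A i ∈ NA A :=
  ⟨Pi.single i 1, by simp [Pi.single_apply]⟩

/-- If the columns generate `ℤ^d`, every integer vector is a difference of elements of `ℕA`. -/
theorem exists_add_mem_NA (A : Matrix (Fin d) (Fin n) ℤ)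
    (hgen : Submodule.span ℤ (Set.range (colZ A)) = ⊤) (β : Fin d → ℤ) :
    ∃ w ∈ NA A, β + w ∈ NA A := by
  have hβ : β ∈ Submodule.span ℤ (Set.range (colZ A)) := hgen ▸ Submodule.mem_top
  obtain ⟨c, rfl⟩ := (Submodule.mem_span_range_iff_exists_fun ℤ).1 hβ
  refine ⟨_, ⟨fun i => (-c i).toNat, rfl⟩, fun i => (c i).toNat, ?_⟩
  rw [← Finset.sum_add_distrib]
  refine Finset.sum_congr rfl fun i _ => ?_
  rw [← add_smul]
  congr 1
  grind

/-- A polynomial vanishing at `v + N • w` for all `N ≥ 1` vanishes at `v`. -/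
theorem mem_zclosure_of_forall_add_nsmul {S : Set (Fin d → ℂ)} (v w : Fin d → ℂ)
    (h : ∀ N : ℕ, v + ((N : ℂ) + 1) • w ∈ S) : v ∈ zclosure S := by
  intro p hp
  set q : Polynomial ℂ :=
    MvPolynomial.aeval (fun k => Polynomial.C (v k) + Polynomial.X * Polynomial.C (w k)) p with hq
  have heval : ∀ t : ℂ, q.eval t = MvPolynomial.eval (v + t • w) p := by
    intro t
    rw [hq, ← Polynomial.coe_evalRingHom, MvPolynomial.aeval_def, MvPolynomial.hom_eval₂,
      MvPolynomial.eval, MvPolynomial.coe_eval₂Hom]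
    congr 1
    · ext; simp
    · ext k
      simp only [Polynomial.coe_evalRingHom, Polynomial.eval_add, Polynomial.eval_mul,
        Polynomial.eval_C, Polynomial.eval_X, Pi.add_apply, Pi.smul_apply, smul_eq_mul]
  have hq0 : q = 0 := by
    refine Polynomial.eq_zero_of_infinite_isRoot q
      ((Set.infinite_range_of_injective (f := fun N : ℕ => (N : ℂ) + 1) ?_).mono ?_)
    · intro x y hxy
      simpa using hxy
    · rintro _ ⟨N, rfl⟩
      exact (heval _).trans (hp _ (h N))
  simpa [hq0] using (heval 0).symm

/-- Integer vectors outside `ℕA` are strongly resonant. -/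
theorem zToC_mem_sRes_of_notMem_NA (A : Matrix (Fin d) (Fin n) ℤ)
    (hgen : Submodule.span ℤ (Set.range (colZ A)) = ⊤) {β : Fin d → ℤ} (hβ : β ∉ NA A) :
    zToC β ∈ sRes A := by
  classical
  -- `P F x` says that `x` lies in the localization of `ℕA` at the columns indexed by `F`.
  let P : Finset (Fin n) → (Fin d → ℤ) → Prop := fun F x =>
    ∃ γ : Fin n → ℕ, x + ∑ i ∈ F, γ i • colZ A i ∈ NA A
  have hempty : ¬ P ∅ β := by
    rintro ⟨γ, h⟩
    exact hβ (by simpa using h)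
  have huniv : P Finset.univ β := by
    obtain ⟨w, ⟨γ, rfl⟩, h⟩ := exists_add_mem_NA A hgen β
    exact ⟨γ, by simpa using h⟩
  obtain ⟨F, j, hjF, hF, hFj⟩ : ∃ (F : Finset (Fin n)) (j : Fin n), j ∉ F ∧ ¬ P F β ∧
      P (insert j F) β := by
    by_contra! hcon
    refine (?_ : ∀ F, ¬ P F β) Finset.univ huniv
    intro F
    induction F using Finset.induction_on with
    | empty => exact hempty
    | insert j F hj ih => exact hcon F j hj ih
  have hex : ∃ k : ℕ, P F (β + k • colZ A j) := by
    obtain ⟨γ, h⟩ := hFj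
    exact ⟨γ j, γ, by rwa [Finset.sum_insert hjF, ← add_assoc] at h⟩
  obtain ⟨l, hl⟩ : ∃ l, Nat.find hex = l + 1 := by
    refine Nat.exists_eq_succ_of_ne_zero fun h0 => hF ?_
    have := Nat.find_spec hex
    rwa [h0, zero_smul, add_zero] at this
  have hspec := Nat.find_spec hex
  have hmin : ¬ P F (β + l • colZ A j) := Nat.find_min hex (by omega)
  rw [hl] at hspec
  obtain ⟨γ, hγ⟩ := hspec
  set w := ∑ i ∈ F, γ i • colZ A i with hw
  have hwNA : w ∈ NA A :=
    Finset.sum_induction _ (· ∈ NA A) (fun _ _ => add_mem_NA) (zero_mem_NA A)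
      fun i _ => nsmul_mem_NA (colZ_mem_NA A i) _
  refine Set.mem_iUnion.2 ⟨j, Set.mem_iUnion.2 ⟨l, zToC (β + (l + 1) • colZ A j), ?_, ?_⟩⟩
  · refine mem_zclosure_of_forall_add_nsmul _ (zToC w) fun N => ?_
    refine ⟨β + (l + 1) • colZ A j + (N + 1) • w, ⟨?_, ?_⟩, ?_⟩
    · have := add_mem_NA hγ (nsmul_mem_NA hwNA N)
      rwa [add_assoc, ← succ_nsmul'] at this
    · rintro ⟨m, hm, heq⟩
      refine hmin ⟨(N + 1) • γ, ?_⟩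
      have hsum : ∑ i ∈ F, ((N + 1) • γ) i • colZ A i = (N + 1) • w := by
        rw [hw, Finset.smul_sum]
        exact Finset.sum_congr rfl fun i _ => by rw [Pi.smul_apply, smul_assoc]
      rw [hsum]
      convert hm
      rw [succ_nsmul (colZ A j)] at heq
      apply add_left_cancel (a := colZ A j)
      rw [← heq]
      abel
    · ext k
      simp [zToC]
  · ext k
    simp [zToC, colC, colZ]

/-- If `ℕA` is saturated, no element of `ℕA` is strongly resonant. -/
theorem zToC_notMem_sRes_of_mem_NA (A : Matrix (Fin d) (Fin n) ℤ)
    (hsat : NA A = {m : Fin d → ℤ | (fun k => (m k : ℚ)) ∈ QplusA A}) {β : Fin d → ℤ}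
    (hβ : β ∈ NA A) : zToC β ∉ sRes A := by
  intro hres
  obtain ⟨j, hres⟩ := Set.mem_iUnion.1 hres
  obtain ⟨l, q, hq, hqβ⟩ := Set.mem_iUnion.1 hres
  obtain ⟨Ψ, hΨ⟩ := exists_finset_mem_NA_iff A hsat
  have hqv : q = zToC (β + (l + 1) • colZ A j) := by
    rw [sub_eq_iff_eq_add.1 hqβ]
    ext k
    simp [zToC, colC, colZ]
  let p : MvPolynomial (Fin d) ℂ := ∏ ψ ∈ Ψ, ∏ c ∈ Finset.Ico 0 (ψ ⬝ᵥ colZ A j),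
    (∑ k, MvPolynomial.C (ψ k : ℂ) * MvPolynomial.X k - MvPolynomial.C (c : ℂ))
  have heval : ∀ m : Fin d → ℤ, MvPolynomial.eval (zToC m) p =
      ∏ ψ ∈ Ψ, ∏ c ∈ Finset.Ico 0 (ψ ⬝ᵥ colZ A j), ((ψ ⬝ᵥ m - c : ℤ) : ℂ) := by
    intro m
    simp [p, zToC, dotProduct]
  have hp := hq p (by
    rintro _ ⟨m, ⟨hm, hmj⟩, rfl⟩
    have hnot : m - colZ A j ∉ NA A := fun h => hmj ⟨_, h, by abel⟩
    rw [hΨ] at hnot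
    push Not at hnot
    obtain ⟨ψ, hψ, hlt⟩ := hnot
    rw [dotProduct_sub] at hlt
    rw [heval]
    refine Finset.prod_eq_zero hψ (Finset.prod_eq_zero (i := ψ ⬝ᵥ m) ?_ (by simp))
    exact Finset.mem_Ico.2 ⟨(hΨ m).1 hm ψ hψ, by omega⟩)
  rw [hqv, heval] at hp
  obtain ⟨ψ, hψ, hp⟩ := Finset.prod_eq_zero_iff.1 hp
  obtain ⟨c, hc, hp⟩ := Finset.prod_eq_zero_iff.1 hp
  rw [Int.cast_eq_zero, dotProduct_add, dotProduct_smul, succ_nsmul] at hp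
  have hβψ := (hΨ β).1 hβ ψ hψ
  have hj := (hΨ _).1 (colZ_mem_NA A j) ψ hψ
  have hlj : 0 ≤ l • (ψ ⬝ᵥ colZ A j) := nsmul_nonneg hj l
  rw [Finset.mem_Ico] at hc
  linarith [hc.2]

/-- If the columns of `A` generate `ℤ^d`, `A` is homogeneous, and `ℕA` is
saturated, then `ℤ^d \ sRes(A) = ℕA`: an integer vector `β` lies outside
`sRes(A)` iff `β ∈ ℕA`. -/
theorem int_not_sRes_iff_mem_NA (hd : 0 < d) (hn : 0 < n)
    (A : Matrix (Fin d) (Fin n) ℤ)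
    (hgen : Submodule.span ℤ (Set.range (colZ A)) = ⊤)
    (hhom : ∃ h : (Fin d → ℤ) →ₗ[ℤ] ℤ, ∀ i, h (colZ A i) = 1)
    (hsat : NA A = {m : Fin d → ℤ | (fun k => (m k : ℚ)) ∈ QplusA A}) :
    ∀ β : Fin d → ℤ, zToC β ∉ sRes A ↔ β ∈ NA A := by
  intro β
  refine ⟨fun h => ?_, zToC_notMem_sRes_of_mem_NA A hsat⟩
  by_contra hβ
  exact h (zToC_mem_sRes_of_notMem_NA A hgen hβ)
end
end

section
/- Suppose the columns a_1,…,a_n of A generate ℤ^d as a ℤ-module, and let β ∈ ℚ^d with β ∉ sRes(A). Then there exists n_β ∈ ℤ such that for every β_0 ∈ ℚ with β_0 ≥ n_β the vector (β_0, β) ∈ ℚ^{d+1} does not lie in sRes(Ã), where Ã is the homogenization of A. -/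
noncomputable section

open scoped BigOperators

variable {d n : ℕ}

/-- The homogenization `Ã` of `A`: the `(d+1) × (n+1)` integer matrix with
columns `ã_0 = (1,0,…,0)` and `ã_i = (1, a_i)`. -/
def homog (A : Matrix (Fin d) (Fin n) ℤ) : Matrix (Fin (d + 1)) (Fin (n + 1)) ℤ :=
  Matrix.of (Fin.cons (fun _ => (1 : ℤ)) (fun k' => Fin.cons 0 (fun i' => A k' i')))

/-- The point `Σ γ_i a_i` of `ℕA` with coefficient vector `γ`. -/
def natComb (A : Matrix (Fin d) (Fin n) ℤ) (γ : Fin n → ℕ) : Fin d → ℤ :=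
  ∑ i, (γ i : ℤ) • colZ A i

theorem natComb_add (A : Matrix (Fin d) (Fin n) ℤ) (γ δ : Fin n → ℕ) :
    natComb A (γ + δ) = natComb A γ + natComb A δ := by
  simp [natComb, add_smul, Finset.sum_add_distrib]

theorem natComb_smul (A : Matrix (Fin d) (Fin n) ℤ) (t : ℕ) (γ : Fin n → ℕ) :
    natComb A (t • γ) = (t : ℤ) • natComb A γ := by
  simp [natComb, mul_smul, Finset.smul_sum]

theorem natComb_single (A : Matrix (Fin d) (Fin n) ℤ) (i : Fin n) :
    natComb A (Pi.single i 1) = colZ A i := by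
  simp [natComb, Pi.single_apply]

theorem natComb_mem_NA (A : Matrix (Fin d) (Fin n) ℤ) (γ : Fin n → ℕ) : natComb A γ ∈ NA A :=
  ⟨γ, rfl⟩

/-- The exponents `γ` with `Σ γ_i a_i ∈ a_j + ℕA`. -/
def shiftExponents (A : Matrix (Fin d) (Fin n) ℤ) (j : Fin n) : Set (Fin n → ℕ) :=
  {γ | ∃ δ, natComb A γ = colZ A j + natComb A δ}

theorem isUpperSet_shiftExponents (A : Matrix (Fin d) (Fin n) ℤ) (j : Fin n) :
    IsUpperSet (shiftExponents A j) := by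
  rintro γ γ' h ⟨δ, hδ⟩
  obtain ⟨ε, rfl⟩ := exists_add_of_le h
  exact ⟨δ + ε, by rw [natComb_add, natComb_add, hδ, add_assoc]⟩

/-- Membership in an upper set of `ℕ^ι` only depends on the truncation of the exponents at a
sufficiently large bound (a form of Dickson's lemma). -/
theorem IsUpperSet.exists_trunc_mem {ι : Type*} [Finite ι] {I : Set (ι → ℕ)}
    (hI : IsUpperSet I) : ∃ M : ℕ, ∀ γ ∈ I, (fun i => min (γ i) M) ∈ I := by
  have := Fintype.ofFinite ι
  have hfin : {g | Minimal (· ∈ I) g}.Finite :=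
    WellQuasiOrderedLE.finite_of_isAntichain (setOfPred_minimal_antichain (· ∈ I))
  refine ⟨hfin.toFinset.sup fun g => Finset.univ.sup g, fun γ hγ => ?_⟩
  obtain ⟨g, hgγ, hg⟩ := exists_minimal_le_of_wellFoundedLT (· ∈ I) γ hγ
  refine hI (fun i => le_min (hgγ i) ?_) hg.prop
  exact (Finset.le_sup (f := g) (Finset.mem_univ i)).trans
    (Finset.le_sup (f := fun g : ι → ℕ => Finset.univ.sup g) (hfin.mem_toFinset.2 hg))

/-- The Farkas lemma over a linearly ordered field. -/
theorem farkas {K ι κ : Type*} [Field K] [LinearOrder K] [IsStrictOrderedRing K] [Fintype κ]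
    (s : Finset ι) (a : ι → κ → K) (b : κ → K) :
    (∃ c : ι → K, (∀ i, 0 ≤ c i) ∧ b = ∑ i ∈ s, c i • a i) ∨
      ∃ x : κ → K, (∀ i ∈ s, 0 ≤ a i ⬝ᵥ x) ∧ b ⬝ᵥ x < 0 := by
  classical
  induction s using Finset.induction_on generalizing a b with
  | empty =>
    by_cases hb : b = 0
    · exact Or.inl ⟨0, fun _ => le_rfl, by simpa using hb⟩
    · refine Or.inr ⟨-b, by simp, ?_⟩
      rw [dotProduct_neg, neg_lt_zero]
      refine lt_of_le_of_ne (Finset.sum_nonneg fun i _ => mul_self_nonneg _) fun h => hb ?_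
      exact dotProduct_self_eq_zero.1 h.symm
  | insert k s hk ih =>
    rcases ih a b with ⟨c, hc, rfl⟩ | ⟨x₀, hx₀, hb₀⟩
    · refine Or.inl ⟨Function.update c k 0, fun i => ?_, ?_⟩
      · rcases eq_or_ne i k with rfl | h <;> simp [*]
      · rw [Finset.sum_insert hk]
        simp only [Function.update_self, zero_smul, zero_add]
        refine Finset.sum_congr rfl fun i hi => ?_
        rw [Function.update_of_ne (ne_of_mem_of_not_mem hi hk)]
    rcases le_or_gt 0 (a k ⬝ᵥ x₀) with hk₀ | hk₀
    · exact Or.inr ⟨x₀, by simpa [hk₀] using hx₀, hb₀⟩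
    obtain ⟨x, hx, hbx, hkx⟩ : ∃ x, (∀ i ∈ s, 0 ≤ a i ⬝ᵥ x) ∧ b ⬝ᵥ x < 0 ∧ a k ⬝ᵥ x = -1 := by
      have hpos : 0 < (-(a k ⬝ᵥ x₀))⁻¹ := inv_pos.2 (neg_pos.2 hk₀)
      refine ⟨(-(a k ⬝ᵥ x₀))⁻¹ • x₀, fun i hi => ?_, ?_, ?_⟩
      · rw [dotProduct_smul]
        exact mul_nonneg hpos.le (hx₀ i hi)
      · rw [dotProduct_smul]
        exact mul_neg_of_pos_of_neg hpos hb₀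
      · rw [dotProduct_smul, smul_eq_mul]
        field_simp [hk₀.ne]
    rcases ih (fun i => a i + (a i ⬝ᵥ x) • a k) (b + (b ⬝ᵥ x) • a k) with
      ⟨c, hc, hb⟩ | ⟨y, hy, hby⟩
    · have hcoef : 0 ≤ ∑ i ∈ s, c i * (a i ⬝ᵥ x) - b ⬝ᵥ x :=
        sub_nonneg.2 (hbx.le.trans (Finset.sum_nonneg fun i hi => mul_nonneg (hc i) (hx i hi)))
      refine Or.inl ⟨Function.update c k (∑ i ∈ s, c i * (a i ⬝ᵥ x) - b ⬝ᵥ x), fun i => ?_, ?_⟩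
      · rcases eq_or_ne i k with rfl | h <;> simp [*]
      · have hupd : ∀ i ∈ s, Function.update c k (∑ i ∈ s, c i * (a i ⬝ᵥ x) - b ⬝ᵥ x) i • a i
            = c i • a i := fun i hi => by
          rw [Function.update_of_ne (ne_of_mem_of_not_mem hi hk)]
        rw [Finset.sum_insert hk, Function.update_self, Finset.sum_congr rfl hupd, sub_smul,
          sub_add_eq_add_sub, eq_sub_iff_add_eq, hb]
        simp only [smul_add, Finset.sum_add_distrib, Finset.sum_smul, mul_smul]
        abel
    · refine Or.inr ⟨y + (a k ⬝ᵥ y) • x, fun i hi => ?_, ?_⟩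
      · rcases Finset.mem_insert.1 hi with rfl | hi
        · simp [dotProduct_add, dotProduct_smul, hkx]
        · have := hy i hi
          simp only [add_dotProduct, smul_dotProduct, smul_eq_mul] at this
          simpa [dotProduct_add, dotProduct_smul, mul_comm] using this
      · simp only [add_dotProduct, smul_dotProduct, smul_eq_mul] at hby
        simpa [dotProduct_add, dotProduct_smul, mul_comm] using hby

/-- Finitely many nonnegative rationals have a common denominator. -/
theorem exists_nat_mul_eq {ι : Type*} [Fintype ι] (c : ι → ℚ) (hc : ∀ i, 0 ≤ c i) :
    ∃ N : ℕ, 0 < N ∧ ∃ e : ι → ℕ, ∀ i, (e i : ℚ) = N * c i := by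
  classical
  refine ⟨∏ i, (c i).den, Finset.prod_pos fun i _ => (c i).den_pos,
    fun i => (∏ k ∈ Finset.univ.erase i, (c k).den) * (c i).num.toNat, fun i => ?_⟩
  have hnum : (((c i).num.toNat : ℕ) : ℚ) = (c i).num := by
    exact_mod_cast Int.toNat_of_nonneg (Rat.num_nonneg.2 (hc i))
  rw [← Finset.prod_erase_mul _ _ (Finset.mem_univ i)]
  push_cast
  rw [hnum, mul_assoc, Rat.den_mul_eq_num]

/-- Either the face of the cone spanned by the columns indexed by `σ` contains `a_j`, witnessed by
an integral relation, or it is cut out by a supporting functional that is positive on `a_j`. -/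
theorem exists_relation_or_functional (A : Matrix (Fin d) (Fin n) ℤ) (σ : Set (Fin n))
    (j : Fin n) :
    (∃ N : ℕ, 0 < N ∧ ∃ c e : Fin n → ℕ, (∀ i ∉ σ, e i = 0) ∧
      (N : ℤ) • colZ A j + natComb A c = natComb A e) ∨
    ∃ h : Fin d → ℚ, (∀ i, 0 ≤ (fun k => (A k i : ℚ)) ⬝ᵥ h) ∧
      (∀ i ∈ σ, (fun k => (A k i : ℚ)) ⬝ᵥ h = 0) ∧ 0 < (fun k => (A k j : ℚ)) ⬝ᵥ h := by
  classical
  let v : Fin n → Fin d → ℚ := fun i k => (A k i : ℚ)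
  rcases farkas Finset.univ (Sum.elim v fun i => if i ∈ σ then -v i else 0) (-v j) with
    ⟨c, hc, hrel⟩ | ⟨h, hh, hj⟩
  · obtain ⟨N, hN, e, he⟩ := exists_nat_mul_eq c hc
    refine Or.inl ⟨N, hN, fun i => e (Sum.inl i),
      fun i => if i ∈ σ then e (Sum.inr i) else 0, fun i hi => by simp [hi], ?_⟩
    ext k
    have hk := congrFun hrel k
    simp only [Fintype.sum_sum_type, Sum.elim_inl, Sum.elim_inr, Finset.sum_apply,
      Pi.smul_apply, smul_eq_mul, Pi.neg_apply, v] at hk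
    have hk' := congrArg (fun t : ℚ => (N : ℚ) * t) hk
    simp only [mul_add, Finset.mul_sum, ← mul_assoc, ← he] at hk'
    have hinr : ∑ i, (e (Sum.inr i) : ℚ) * (if i ∈ σ then -v i else 0) k
        = -∑ i, ((if i ∈ σ then e (Sum.inr i) else 0 : ℕ) : ℚ) * (A k i : ℚ) := by
      rw [← Finset.sum_neg_distrib]
      refine Finset.sum_congr rfl fun i _ => ?_
      split_ifs <;> simp [v]
    rw [hinr] at hk'
    have : (N : ℚ) * A k j + ∑ i, (e (Sum.inl i) : ℚ) * (A k i : ℚ)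
        = ∑ i, ((if i ∈ σ then e (Sum.inr i) else 0 : ℕ) : ℚ) * (A k i : ℚ) := by
      linarith
    simp only [natComb, colZ, Pi.add_apply, Finset.sum_apply, Pi.smul_apply, smul_eq_mul]
    exact_mod_cast this
  · refine Or.inr ⟨h, fun i => hh (Sum.inl i) (Finset.mem_univ _), fun i hi => ?_, ?_⟩
    · have h₁ := hh (Sum.inl i) (Finset.mem_univ _)
      have h₂ := hh (Sum.inr i) (Finset.mem_univ _)
      simp only [Sum.elim_inl, Sum.elim_inr, if_pos hi, neg_dotProduct] at h₁ h₂
      exact le_antisymm (by simpa [v] using h₂) h₁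
    · simpa [neg_dotProduct, v] using hj

theorem zclosure_mono {S T : Set (Fin d → ℂ)} (h : S ⊆ T) : zclosure S ⊆ zclosure T :=
  fun _ hx p hp => hx p fun s hs => hp s (h hs)

theorem exists_mem_zclosure_of_mem_zclosure_iUnion {ι : Type*} [Finite ι]
    {S : ι → Set (Fin d → ℂ)} {x : Fin d → ℂ} (hx : x ∈ zclosure (⋃ i, S i)) :
    ∃ i, x ∈ zclosure (S i) := by
  have := Fintype.ofFinite ι
  by_contra! hcon
  have hp : ∀ i, ∃ p : MvPolynomial (Fin d) ℂ,
      (∀ s ∈ S i, MvPolynomial.eval s p = 0) ∧ MvPolynomial.eval x p ≠ 0 := by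
    simpa [zclosure] using hcon
  choose p hpS hpx using hp
  have h0 := hx (∏ i, p i) fun s hs => by
    obtain ⟨i, hi⟩ := Set.mem_iUnion.1 hs
    rw [map_prod]
    exact Finset.prod_eq_zero (Finset.mem_univ i) (hpS i s hi)
  rw [map_prod, Finset.prod_eq_zero_iff] at h0
  obtain ⟨i, -, hi⟩ := h0
  exact hpx i hi

theorem tail_mem_zclosure {S : Set (Fin (d + 1) → ℂ)} {T : Set (Fin d → ℂ)}
    (h : ∀ s ∈ S, Fin.tail s ∈ T) {x : Fin (d + 1) → ℂ} (hx : x ∈ zclosure S) :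
    Fin.tail x ∈ zclosure T := by
  intro p hp
  have := hx (MvPolynomial.rename Fin.succ p) fun s hs => by
    rw [MvPolynomial.eval_rename]
    exact hp _ (h s hs)
  rwa [MvPolynomial.eval_rename] at this

theorem dotProduct_eq_of_mem_zclosure {S : Set (Fin d → ℂ)} {h : Fin d → ℂ} {t : ℂ}
    (hS : ∀ s ∈ S, s ⬝ᵥ h = t) {x : Fin d → ℂ} (hx : x ∈ zclosure S) : x ⬝ᵥ h = t := by
  have heval : ∀ y : Fin d → ℂ, MvPolynomial.eval y
      (∑ k, MvPolynomial.X k * MvPolynomial.C (h k) - MvPolynomial.C t) = y ⬝ᵥ h - t := by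
    intro y
    simp [dotProduct]
  have := hx _ fun s hs => by rw [heval, hS s hs, sub_self]
  rwa [heval, sub_eq_zero] at this

/-- The exponents whose truncation at `M` is `b`. -/
def truncFiber (M : ℕ) (b : Fin n → Fin (M + 1)) : Set (Fin n → ℕ) :=
  {γ | ∀ i, min (γ i) M = b i}

theorem add_mem_truncFiber {M : ℕ} {b : Fin n → Fin (M + 1)} {γ e : Fin n → ℕ}
    (hγ : γ ∈ truncFiber M b) (he : ∀ i, (b i : ℕ) ≠ M → e i = 0) : γ + e ∈ truncFiber M b := by
  intro i
  have h := hγ i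
  have := he i
  simp only [Pi.add_apply]
  omega

/-- `qdeg_j(A)` is covered by the Zariski closures of finitely many translated faces, each
avoiding `a_j + ℕA`. -/
theorem exists_truncFiber_cover (A : Matrix (Fin d) (Fin n) ℤ) (j : Fin n) :
    ∃ M : ℕ, ∀ q ∈ qdeg A j, ∃ b : Fin n → Fin (M + 1),
      (∀ γ ∈ truncFiber M b, γ ∉ shiftExponents A j) ∧
        q ∈ zclosure ((fun γ => zToC (natComb A γ)) '' truncFiber M b) := by
  obtain ⟨M, hM⟩ := (isUpperSet_shiftExponents A j).exists_trunc_mem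
  refine ⟨M, fun q hq => ?_⟩
  let B := {b : Fin n → Fin (M + 1) // ∀ γ ∈ truncFiber M b, γ ∉ shiftExponents A j}
  have hcover : zToC '' (NA A \ {m | ∃ m' ∈ NA A, m = colZ A j + m'}) ⊆
      ⋃ b : B, (fun γ => zToC (natComb A γ)) '' truncFiber M b.1 := by
    rintro _ ⟨_, ⟨⟨γ, rfl⟩, hγ⟩, rfl⟩
    have hγ' : γ ∉ shiftExponents A j := fun ⟨δ, hδ⟩ => hγ ⟨_, natComb_mem_NA A δ, hδ⟩
    refine Set.mem_iUnion.2 ⟨⟨fun i => ⟨min (γ i) M, by omega⟩, fun γ' hmem hγ'I => hγ' ?_⟩,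
      γ, fun i => rfl, rfl⟩
    refine isUpperSet_shiftExponents A j (fun i => ?_) (hM γ' hγ'I)
    exact (hmem i).le.trans (min_le_left _ _)
  obtain ⟨b, hb⟩ := exists_mem_zclosure_of_mem_zclosure_iUnion (zclosure_mono hcover hq)
  exact ⟨b.1, b.2, hb⟩

theorem natComb_dotProduct (A : Matrix (Fin d) (Fin n) ℤ) (γ : Fin n → ℕ) (h : Fin d → ℚ) :
    (fun k => (natComb A γ k : ℚ)) ⬝ᵥ h = ∑ i, (γ i : ℚ) * ((fun k => (A k i : ℚ)) ⬝ᵥ h) := by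
  have : (fun k => (natComb A γ k : ℚ)) = ∑ i, (γ i : ℚ) • fun k => (A k i : ℚ) := by
    ext k
    simp [natComb, colZ]
  rw [this, sum_dotProduct]
  simp

theorem tail_natComb_homog (A : Matrix (Fin d) (Fin n) ℤ) (γ : Fin (n + 1) → ℕ) :
    Fin.tail (natComb (homog A) γ) = natComb A (Fin.tail γ) := by
  ext k
  simp [natComb, colZ, homog, Fin.tail, Fin.sum_univ_succ]

theorem tail_colZ_homog_succ (A : Matrix (Fin d) (Fin n) ℤ) (j : Fin n) :
    Fin.tail (colZ (homog A) j.succ) = colZ A j := by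
  ext k
  simp [colZ, homog, Fin.tail]

theorem colZ_homog_zero (A : Matrix (Fin d) (Fin n) ℤ) :
    colZ (homog A) 0 = Pi.single 0 1 := by
  ext k
  refine Fin.cases ?_ (fun k => ?_) k <;> simp [colZ, homog]

/-- A translated face of `Ã` containing `ã_0` and avoiding `ã_j + ℕÃ` projects into the complement
of `a_j + ℕA`. -/
theorem tail_notMem_shiftExponents (A : Matrix (Fin d) (Fin n) ℤ) {M : ℕ}
    {b : Fin (n + 1) → Fin (M + 1)} {j : Fin n}
    (hb : ∀ γ ∈ truncFiber M b, γ ∉ shiftExponents (homog A) j.succ) {N : ℕ} (hN : 0 < N)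
    {c e : Fin (n + 1) → ℕ} (he : ∀ i, (b i : ℕ) ≠ M → e i = 0)
    (hrel : (N : ℤ) • colZ (homog A) 0 + natComb (homog A) c = natComb (homog A) e)
    {γ : Fin (n + 1) → ℕ} (hγ : γ ∈ truncFiber M b) :
    Fin.tail γ ∉ shiftExponents A j := by
  rintro ⟨δ, hδ⟩
  let δ' : Fin (n + 1) → ℕ := Fin.cons 0 δ
  let z : ℤ := natComb (homog A) γ 0 - colZ (homog A) j.succ 0 - natComb (homog A) δ' 0
  have hz : natComb (homog A) γ
      = colZ (homog A) j.succ + natComb (homog A) δ' + z • colZ (homog A) 0 := by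
    rw [colZ_homog_zero]
    ext k
    refine Fin.cases ?_ (fun k => ?_) k
    · simp [z]
    · have h₁ := congrFun (tail_natComb_homog A γ) k
      have h₂ := congrFun (tail_natComb_homog A δ') k
      have h₃ := congrFun (tail_colZ_homog_succ A j) k
      have h₄ := congrFun hδ k
      simp only [Fin.tail_cons, δ'] at h₂
      simp only [Fin.tail, Pi.add_apply] at h₁ h₂ h₃ h₄
      simp [h₁, h₃, h₄, δ', h₂]
  let t : ℕ := z.natAbs
  have ht : 0 ≤ z + t * N := by
    have : (t : ℤ) * 1 ≤ t * N := by gcongr; exact_mod_cast hN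
    omega
  refine hb (γ + t • e) (add_mem_truncFiber hγ fun i hi => by simp [he i hi])
    ⟨δ' + t • c + (z + t * N).toNat • Pi.single 0 1, ?_⟩
  rw [natComb_add, natComb_add, natComb_add, natComb_smul, natComb_smul, natComb_smul,
    natComb_single, ← hrel, hz, Int.toNat_of_nonneg ht]
  module

/-- A translated face of `Ã` whose span is cut out by a functional positive on `ã_0` meets the
relevant lines in the direction `ã_0` only in bounded degree. -/
theorem notMem_zclosure_truncFiber_of_functional (A : Matrix (Fin d) (Fin n) ℤ) {M : ℕ}
    (b : Fin n → Fin (M + 1)) {h : Fin d → ℚ} (hnonneg : ∀ i, 0 ≤ (fun k => (A k i : ℚ)) ⬝ᵥ h)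
    (hzero : ∀ i, (b i : ℕ) = M → (fun k => (A k i : ℚ)) ⬝ᵥ h = 0) (j : Fin n) (l : ℕ)
    {β : Fin d → ℚ} (hβ : ∑ i, (b i : ℚ) * ((fun k => (A k i : ℚ)) ⬝ᵥ h) < β ⬝ᵥ h) :
    qToC β + ((l : ℂ) + 1) • colC A j ∉
      zclosure ((fun γ => zToC (natComb A γ)) '' truncFiber M b) := by
  intro hmem
  have hcast : ∀ x : Fin d → ℚ, qToC x ⬝ᵥ qToC h = ((x ⬝ᵥ h : ℚ) : ℂ) := fun x => by
    simp [qToC, dotProduct]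
  have hconst : ∀ s ∈ (fun γ => zToC (natComb A γ)) '' truncFiber M b,
      s ⬝ᵥ qToC h = ((∑ i, (b i : ℚ) * ((fun k => (A k i : ℚ)) ⬝ᵥ h) : ℚ) : ℂ) := by
    rintro _ ⟨γ, hγ, rfl⟩
    have hz : zToC (natComb A γ) = qToC fun k => (natComb A γ k : ℚ) := by
      ext k; simp [zToC, qToC]
    dsimp only
    rw [hz, hcast, natComb_dotProduct]
    congr 1
    refine Finset.sum_congr rfl fun i _ => ?_
    by_cases hi : (b i : ℕ) = M
    · rw [hzero i hi, mul_zero, mul_zero]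
    · have := hγ i
      have hγi : γ i = b i := by omega
      rw [hγi]
  have hval := dotProduct_eq_of_mem_zclosure hconst hmem
  have hpt : qToC β + ((l : ℂ) + 1) • colC A j
      = qToC (β + ((l : ℚ) + 1) • fun k => (A k j : ℚ)) := by
    ext k; simp [qToC, colC]
  rw [hpt, hcast, Rat.cast_inj, add_dotProduct, smul_dotProduct, smul_eq_mul] at hval
  have : 0 ≤ ((l : ℚ) + 1) * ((fun k => (A k j : ℚ)) ⬝ᵥ h) := mul_nonneg (by positivity) (hnonneg j)
  linarith

theorem eventually_notMem_zclosure_truncFiber (A : Matrix (Fin d) (Fin n) ℤ) {β : Fin d → ℚ}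
    (hβ : qToC β ∉ sRes A) (j : Fin (n + 1)) {M : ℕ} (b : Fin (n + 1) → Fin (M + 1))
    (hb : ∀ γ ∈ truncFiber M b, γ ∉ shiftExponents (homog A) j) :
    ∀ᶠ β₀ : ℚ in Filter.atTop, ∀ l : ℕ,
      qToC (Fin.cons β₀ β) + ((l : ℂ) + 1) • colC (homog A) j ∉
        zclosure ((fun γ => zToC (natComb (homog A) γ)) '' truncFiber M b) := by
  rcases exists_relation_or_functional (homog A) {i | (b i : ℕ) = M} 0 with
    ⟨N, hN, c, e, he, hrel⟩ | ⟨h, hnonneg, hzero, hpos⟩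
  · refine Filter.Eventually.of_forall fun β₀ l hmem => ?_
    induction j using Fin.cases with
    | zero =>
      have hb' : (fun i => (b i : ℕ)) ∈ truncFiber M b := fun i => by
        have := (b i).is_lt
        dsimp only
        omega
      refine hb _ (add_mem_truncFiber hb' he)
        ⟨(fun i => (b i : ℕ)) + c + (N - 1) • Pi.single 0 1, ?_⟩
      rw [natComb_add, natComb_add, natComb_add, natComb_smul, natComb_single, ← hrel,
        Nat.cast_sub hN, Nat.cast_one]
      module
    | succ j =>
      refine hβ (Set.mem_iUnion.2 ⟨j, Set.mem_iUnion.2 ⟨l, ?_⟩⟩)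
      refine ⟨qToC β + ((l : ℂ) + 1) • colC A j, ?_, add_sub_cancel_right _ _⟩
      have htail : Fin.tail (qToC (Fin.cons β₀ β) + ((l : ℂ) + 1) • colC (homog A) j.succ)
          = qToC β + ((l : ℂ) + 1) • colC A j := by
        ext k; simp [Fin.tail, qToC, colC, homog]
      rw [← htail]
      refine tail_mem_zclosure ?_ hmem
      rintro _ ⟨γ, hγ, rfl⟩
      refine ⟨natComb A (Fin.tail γ), ⟨natComb_mem_NA A _, ?_⟩, ?_⟩
      · rintro ⟨_, ⟨δ, rfl⟩, hδ⟩
        exact tail_notMem_shiftExponents A hb hN he hrel hγ ⟨δ, hδ⟩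
      · rw [← tail_natComb_homog]
        rfl
  · have hpos' : 0 < h 0 := by
      simpa [homog, dotProduct, Fin.sum_univ_succ] using hpos
    filter_upwards [Filter.eventually_gt_atTop
      ((∑ i, (b i : ℚ) * ((fun k => (homog A k i : ℚ)) ⬝ᵥ h) - β ⬝ᵥ Fin.tail h) / h 0)]
      with β₀ hβ₀ l
    refine notMem_zclosure_truncFiber_of_functional (homog A) b hnonneg hzero j l ?_
    have hcons : (Fin.cons β₀ β : Fin (d + 1) → ℚ) ⬝ᵥ h = β₀ * h 0 + β ⬝ᵥ Fin.tail h := by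
      simp [dotProduct, Fin.sum_univ_succ, Fin.tail]
    rw [div_lt_iff₀ hpos'] at hβ₀
    rw [hcons]
    linarith

/-- If the columns of `A` generate `ℤ^d` and `β ∈ ℚ^d` is not strongly
resonant for `A`, then there is `n_β ∈ ℤ` such that `(β_0, β) ∉ sRes(Ã)`
for every rational `β_0 ≥ n_β`. -/
theorem betalift (hd : 0 < d) (hn : 0 < n)
    (A : Matrix (Fin d) (Fin n) ℤ)
    (hgen : Submodule.span ℤ (Set.range (colZ A)) = ⊤)
    (β : Fin d → ℚ) (hβ : qToC β ∉ sRes A) :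
    ∃ nβ : ℤ, ∀ β₀ : ℚ, (nβ : ℚ) ≤ β₀ →
      qToC (Fin.cons β₀ β) ∉ sRes (homog A) := by
  have hev : ∀ᶠ β₀ : ℚ in Filter.atTop, qToC (Fin.cons β₀ β) ∉ sRes (homog A) := by
    choose M hM using exists_truncFiber_cover (homog A)
    have h : ∀ᶠ β₀ : ℚ in Filter.atTop, ∀ (j : Fin (n + 1)) (b : Fin (n + 1) → Fin (M j + 1)),
        (∀ γ ∈ truncFiber (M j) b, γ ∉ shiftExponents (homog A) j) → ∀ l : ℕ,
          qToC (Fin.cons β₀ β) + ((l : ℂ) + 1) • colC (homog A) j ∉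
            zclosure ((fun γ => zToC (natComb (homog A) γ)) '' truncFiber (M j) b) :=
      Filter.eventually_all.2 fun j => Filter.eventually_all.2 fun b =>
        Filter.eventually_imp_distrib_left.2 fun hb =>
          eventually_notMem_zclosure_truncFiber A hβ j b hb
    filter_upwards [h] with β₀ hβ₀ hmem
    obtain ⟨j, hj⟩ := Set.mem_iUnion.1 hmem
    obtain ⟨l, q, hq, hql⟩ := Set.mem_iUnion.1 hj
    obtain ⟨b, hb, hqb⟩ := hM j q hq
    refine hβ₀ j b hb l ?_
    rwa [← hql, sub_add_cancel]
  obtain ⟨B, hB⟩ := Filter.eventually_atTop.1 hev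
  exact ⟨⌈B⌉, fun β₀ hβ₀ => hB β₀ ((Int.le_ceil B).trans hβ₀)⟩
end
end
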